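/- Let χ be an order type in general position on a finite set V with |V| = n ≥ 4, and suppose h_1, h_2, h_3 is a convex hull sequence of χ (a triangular convex hull). Then for every v ∈ V, the graph T_v is 3-connected. -/

import Mathlib

/-- The 2×2 determinant of two vectors in `ℝ²`. -/
def det2 (x y : ℝ × ℝ) : ℝ := x.1 * y.2 - x.2 * y.1

/-- An order type in general position on `V`: values in `{-1,+1}` on pairwise distinct
triples and `0` otherwise, alternating, and satisfying the GP axiom. -/
def IsOrderType {V : Type*} (χ : V → V → V → ℤ) : Prop :=
  (∀ a b c : V, a ≠ b → a ≠ c → b ≠ c → χ a b c = 1 ∨ χ a b c = -1) ∧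
  (∀ a b c : V, a = b ∨ a = c ∨ b = c → χ a b c = 0) ∧
  (∀ a b c : V, χ b a c = -χ a b c) ∧
  (∀ a b c : V, χ a c b = -χ a b c) ∧
  (∀ x a b c d : V, x ≠ a → x ≠ b → x ≠ c → x ≠ d → a ≠ b → a ≠ c → a ≠ d →
    b ≠ c → b ≠ d → c ≠ d →
    ((χ x a b * χ x c d = -1 ∨ -(χ x a c * χ x b d) = -1 ∨ χ x a d * χ x b c = -1) ∧
     (χ x a b * χ x c d = 1 ∨ -(χ x a c * χ x b d) = 1 ∨ χ x a d * χ x b c = 1)))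

/-- A convex hull sequence of `χ`: a cyclic sequence `h 0, …, h (t-1)` (`t ≥ 3`) of distinct
elements with `χ (h i) (h (i+1)) v = 1` for every `i` (mod `t`) and every other `v`. -/
def IsConvexHullSeq {V : Type*} (χ : V → V → V → ℤ) (t : ℕ) (h : ZMod t → V) : Prop :=
  3 ≤ t ∧ Function.Injective h ∧
  ∀ i : ZMod t, ∀ v : V, v ≠ h i → v ≠ h (i + 1) → χ (h i) (h (i + 1)) v = 1

/-- A hull element: an element appearing in some convex hull sequence of `χ`. -/
def IsHullElement {V : Type*} (χ : V → V → V → ℤ) (x : V) : Prop :=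
  ∃ (t : ℕ) (h : ZMod t → V), IsConvexHullSeq χ t h ∧ x ∈ Set.range h

/-- A hull surrounding sequence of a hull element `h`: an enumeration of `V \ {h}` with
`χ v_j h v_{j+1} = 1` for consecutive entries. -/
def IsHullSurroundSeq {V : Type*} (χ : V → V → V → ℤ) (h : V) (s : List V) : Prop :=
  s.Nodup ∧ (∀ x : V, x ∈ s ↔ x ≠ h) ∧ s.Chain' (fun a b => χ a h b = 1)

/-- An internal surrounding sequence of a non-hull element `v`: an enumeration of `V \ {v}`
which is cyclically `χ`-increasing around `v`, and with exactly one sign change of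
`χ v₁ v ·` along the sequence. -/
def IsInternalSurroundSeq {V : Type*} (χ : V → V → V → ℤ) (v : V) (s : List V) : Prop :=
  s.Nodup ∧ (∀ x : V, x ∈ s ↔ x ≠ v) ∧
  s.Chain' (fun a b => χ a v b = 1) ∧
  (∀ a b : V, s.getLast? = some a → s.head? = some b → χ a v b = 1) ∧
  ∃! p : ℕ, 0 < p ∧ p + 1 < s.length ∧
    (∀ j : ℕ, 0 < j → j ≤ p → χ (s.getD 0 v) v (s.getD j v) = 1) ∧
    (∀ j : ℕ, p < j → j < s.length → χ (s.getD 0 v) v (s.getD j v) = -1)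

/-- The cyclic triangle `h₁, h₂, h₃` as a map `ZMod 3 → V`. -/
def tripleHull {V : Type*} (h₁ h₂ h₃ : V) : ZMod 3 → V :=
  fun i => if i = 0 then h₁ else if i = 1 then h₂ else h₃

/-- The wheel graph `W_v` on `V` determined by the surrounding sequence `s` of `v`:
the cycle through consecutive entries of `s` (taken cyclically) plus all spokes from `v`. -/
def wheelGraph {V : Type*} (v : V) (s : List V) : SimpleGraph V :=
  SimpleGraph.fromRel (fun a b =>
    (a = v ∧ b ∈ s) ∨
    (∃ i : ℕ, i + 1 < s.length ∧ s.getD i v = a ∧ s.getD (i + 1) v = b) ∨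
    (s.getLast? = some a ∧ s.head? = some b))

/-- The vertex set of `T_v`: the four frame vertices `t₁,…,t₄` together with three copies
of the non-hull elements. -/
def TVert (V : Type*) (h₁ h₂ h₃ : V) : Type _ :=
  Fin 4 ⊕ ({x : V // x ≠ h₁ ∧ x ≠ h₂ ∧ x ≠ h₃} × Fin 3)

/-- The embedding of copy `i` of `V` into the vertex set of `T_v`: a non-hull element `u`
goes to `(u, i)`; the hull `h₁,h₂,h₃` is mapped (with `t₁,t₂,t₃,t₄` being `0,1,2,3`) to
`t₁,t₄,t₃` for copy `0`, to `t₂,t₄,t₁` for copy `1`, and to `t₃,t₄,t₂` for copy `2`. -/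
def copyMap {V : Type*} [DecidableEq V] (h₁ h₂ h₃ : V) (i : Fin 3) (u : V) :
    TVert V h₁ h₂ h₃ :=
  if hu : u ≠ h₁ ∧ u ≠ h₂ ∧ u ≠ h₃ then Sum.inr (⟨u, hu⟩, i)
  else if u = h₂ then Sum.inl 3
  else if u = h₁ then Sum.inl (Fin.castLE (by norm_num) i)
  else Sum.inl (Fin.castLE (by norm_num) (i + 2))

/-- The graph `T_v`: the complete frame on `t₁,…,t₄` together with the images of the three
copies of the wheel graph `W_v` under the copy maps. -/
def TGraph {V : Type*} [DecidableEq V] (h₁ h₂ h₃ : V) (v : V) (s : List V) :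
    SimpleGraph (TVert V h₁ h₂ h₃) :=
  SimpleGraph.fromRel (fun a b =>
    (∃ x y : Fin 4, a = Sum.inl x ∧ b = Sum.inl y) ∨
    (∃ (i : Fin 3) (u w : V), (wheelGraph v s).Adj u w ∧
      a = copyMap h₁ h₂ h₃ i u ∧ b = copyMap h₁ h₂ h₃ i w))

/-- `φ` induces a plane straight-line drawing of `G`: `φ` is injective, any two distinct
edges intersect exactly in the images of their common endpoints, and no vertex image lies
on the closed segment of an edge not containing that vertex. -/
def IsPlaneDrawing {U : Type*} (G : SimpleGraph U) (φ : U → ℝ × ℝ) : Prop :=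
  Function.Injective φ ∧
  (∀ a b c d : U, G.Adj a b → G.Adj c d → s(a, b) ≠ s(c, d) →
    segment ℝ (φ a) (φ b) ∩ segment ℝ (φ c) (φ d) =
      φ '' (({a, b} : Set U) ∩ {c, d})) ∧
  (∀ a b x : U, G.Adj a b → x ≠ a → x ≠ b → φ x ∉ segment ℝ (φ a) (φ b))

/-- `f` realizes the order type `χ` by points in the plane. -/
def Realizes {V : Type*} (χ : V → V → V → ℤ) (f : V → ℝ × ℝ) : Prop :=
  Function.Injective f ∧
  ∀ a b c : V, a ≠ b → a ≠ c → b ≠ c →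
    χ a b c = (SignType.sign (det2 (f c - f a) (f b - f a)) : ℤ)

/-- `G` is 3-connected: removing any at most two vertices leaves a connected graph. -/
def ThreeConnected {U : Type*} (G : SimpleGraph U) : Prop :=
  ∀ S : Set U, S.ncard ≤ 2 → (G.induce Sᶜ).Connected

/-- The wheel graph with rim of length `n`: rim vertices `Fin n` consecutively adjacent
(mod `n`) and a hub adjacent to every rim vertex. -/
def wheel (n : ℕ) : SimpleGraph (Fin n ⊕ Unit) :=
  SimpleGraph.fromRel (fun a b =>
    (∃ i j : Fin n, (j : ℕ) = ((i : ℕ) + 1) % n ∧ a = Sum.inl i ∧ b = Sum.inl j) ∨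
    (∃ i : Fin n, a = Sum.inr () ∧ b = Sum.inl i))

/-- No three points of `P` are collinear. -/
def NoThreeCollinear (P : Set (ℝ × ℝ)) : Prop :=
  ∀ a ∈ P, ∀ b ∈ P, ∀ c ∈ P, a ≠ b → a ≠ c → b ≠ c → det2 (b - a) (c - a) ≠ 0

/-- `q` is a counterclockwise radial order of `P \ {p}` around `p`. -/
def CCWRadialOrder (P : Set (ℝ × ℝ)) (p : ℝ × ℝ) (q : List (ℝ × ℝ)) : Prop :=
  q.Nodup ∧ (∀ x : ℝ × ℝ, x ∈ q ↔ x ∈ P \ {p}) ∧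
  ∀ j : ℕ, j < q.length →
    0 < det2 (q.getD j p - p) (q.getD ((j + 1) % q.length) p - p) ∧
    ∀ r ∈ P, r ≠ p → r ≠ q.getD j p → r ≠ q.getD ((j + 1) % q.length) p →
      ¬(0 < det2 (q.getD j p - p) (r - p) ∧
        0 < det2 (r - p) (q.getD ((j + 1) % q.length) p - p))

/-- The edges (as ordered pairs of endpoints) of the straight-line drawing of the wheel
with hub `p` and rim cycle `q`: the spokes `(p, qⱼ)` and the rim edges `(qⱼ, q_{j+1})`,
indices mod the length of `q`. -/
def wheelEdgePairs (p : ℝ × ℝ) (q : List (ℝ × ℝ)) : Set ((ℝ × ℝ) × (ℝ × ℝ)) :=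
  {e | ∃ j : ℕ, j < q.length ∧
    (e = (p, q.getD j p) ∨ e = (q.getD j p, q.getD ((j + 1) % q.length) p))}

/-- The straight-line drawing of the wheel with hub `p` and rim cycle `q` is plane: any two
distinct segments among the spokes and rim edges intersect exactly in their common
endpoints. -/
def WheelDrawingPlane (p : ℝ × ℝ) (q : List (ℝ × ℝ)) : Prop :=
  ∀ e₁ ∈ wheelEdgePairs p q, ∀ e₂ ∈ wheelEdgePairs p q,
    s(e₁.1, e₁.2) ≠ s(e₂.1, e₂.2) →
    segment ℝ e₁.1 e₁.2 ∩ segment ℝ e₂.1 e₂.2 =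
      ({e₁.1, e₁.2} : Set (ℝ × ℝ)) ∩ {e₂.1, e₂.2}

theorem wheelGraph_adj_hub {V : Type*} {v : V} {s : List V} {x : V} (hx : x ∈ s)
    (hvx : v ≠ x) : (wheelGraph v s).Adj v x := by
  rw [wheelGraph, SimpleGraph.fromRel_adj]
  exact ⟨hvx, Or.inl (Or.inl ⟨rfl, hx⟩)⟩

theorem wheelGraph_adj_rim {V : Type*} {v : V} {s : List V} (hs : s.Nodup)
    (hlen : 2 ≤ s.length) (j : ℕ) :
    (wheelGraph v s).Adj (s[j % s.length]'(Nat.mod_lt _ (by omega)))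
      (s[(j + 1) % s.length]'(Nat.mod_lt _ (by omega))) := by
  have hj : j % s.length < s.length := Nat.mod_lt _ (by omega)
  have hstep : (j + 1) % s.length =
      if j % s.length + 1 = s.length then 0 else j % s.length + 1 := by
    rw [Nat.add_mod_eq_ite, Nat.mod_eq_of_lt (show 1 < s.length by omega)]
    split_ifs <;> omega
  rw [wheelGraph, SimpleGraph.fromRel_adj]
  refine ⟨fun h => ?_, Or.inl (Or.inr ?_)⟩
  · rw [hs.getElem_inj_iff, hstep] at h
    split_ifs at h <;> omega
  · by_cases hlast : j % s.length + 1 = s.length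
    · right
      simp only [hstep, if_pos hlast]
      rw [List.getLast?_eq_getElem?, List.head?_eq_getElem?]
      have : s.length - 1 = j % s.length := by omega
      simp [this, List.getElem?_eq_getElem hj,
        List.getElem?_eq_getElem (show 0 < s.length by omega)]
    · left
      refine ⟨j % s.length, by omega, List.getD_eq_getElem _ _ hj, ?_⟩
      simp only [hstep, if_neg hlast]
      exact List.getD_eq_getElem _ _ (by omega)

/-- Deleting the hub and at most one rim vertex from a wheel leaves a connected path. -/
theorem wheelGraph_induce_connected_of_hub_mem {V : Type*} {v : V} {s : List V}
    (hs : s.Nodup) (hmem : ∀ x : V, x ∈ s ↔ x ≠ v) (hlen : 2 ≤ s.length) {A : Set V}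
    (hv : v ∈ A) {k : ℕ} (hk : k < s.length) (hA : ∀ x ∈ s, x ∈ A → x = s[k]) :
    ((wheelGraph v s).induce Aᶜ).Connected := by
  have hm (i : ℕ) : (k + 1 + i) % s.length < s.length := Nat.mod_lt _ (by omega)
  have hsurv (i : ℕ) (hi : i + 1 < s.length) : s[(k + 1 + i) % s.length]'(hm i) ∈ Aᶜ := by
    intro hiA
    have heq := hA _ (List.getElem_mem _) hiA
    rw [hs.getElem_inj_iff] at heq
    rcases Nat.lt_or_ge (k + 1 + i) s.length with h | h
    · rw [Nat.mod_eq_of_lt h] at heq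
      omega
    · rw [Nat.mod_eq_sub_mod h, Nat.mod_eq_of_lt (by omega)] at heq
      omega
  rw [SimpleGraph.connected_iff_exists_forall_reachable]
  refine ⟨⟨_, hsurv 0 (by omega)⟩, ?_⟩
  have hreach (i : ℕ) (hi : i + 1 < s.length) :
      ((wheelGraph v s).induce Aᶜ).Reachable ⟨_, hsurv 0 (by omega)⟩ ⟨_, hsurv i hi⟩ := by
    induction i with
    | zero => exact SimpleGraph.Reachable.refl _
    | succ i ih =>
      refine (ih (by omega)).trans (SimpleGraph.Adj.reachable ?_)
      exact wheelGraph_adj_rim hs hlen (k + 1 + i)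
  rintro ⟨x, hx⟩
  have hxs : x ∈ s := (hmem x).2 fun h => hx (h ▸ hv)
  obtain ⟨j, hj, rfl⟩ := List.getElem_of_mem hxs
  by_cases hjk : j = k
  · subst hjk
    have hall (i : ℕ) (hi : i < s.length) (hij : i ≠ j) : s[i] ∉ A := fun h =>
      hij ((hs.getElem_inj_iff).1 (hA _ (List.getElem_mem _) h))
    have hlast := hreach (s.length - 2) (by omega)
    refine hlast.trans (SimpleGraph.Adj.reachable ?_)
    have hadj := wheelGraph_adj_rim (v := v) hs hlen (j + 1 + (s.length - 2))
    have h1 : (j + 1 + (s.length - 2) + 1) % s.length = j := by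
      rw [show j + 1 + (s.length - 2) + 1 = j + s.length by omega, Nat.add_mod_right,
        Nat.mod_eq_of_lt hj]
    simp only [h1] at hadj
    exact hadj
  · rcases Nat.lt_or_gt_of_ne hjk with h | h
    · have := hreach (j + s.length - (k + 1)) (by omega)
      have h1 : (k + 1 + (j + s.length - (k + 1))) % s.length = j := by
        rw [show k + 1 + (j + s.length - (k + 1)) = j + s.length by omega, Nat.add_mod_right,
          Nat.mod_eq_of_lt hj]
      simpa only [h1] using this
    · have := hreach (j - (k + 1)) (by omega)
      have h1 : (k + 1 + (j - (k + 1))) % s.length = j := by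
        rw [show k + 1 + (j - (k + 1)) = j by omega, Nat.mod_eq_of_lt hj]
      simpa only [h1] using this

theorem wheelGraph_threeConnected {V : Type*} [Finite V] {v : V} {s : List V}
    (hs : s.Nodup) (hmem : ∀ x : V, x ∈ s ↔ x ≠ v) (hlen : 2 ≤ s.length) :
    ThreeConnected (wheelGraph v s) := by
  intro A hA
  by_cases hv : v ∈ A
  · have hcard : (A \ {v}).ncard ≤ 1 := by
      rw [Set.ncard_sdiff_singleton_of_mem hv]
      omega
    rw [Set.ncard_le_one] at hcard
    by_cases hex : ∃ x ∈ s, x ∈ A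
    · obtain ⟨x, hxs, hxA⟩ := hex
      obtain ⟨k, hk, rfl⟩ := List.getElem_of_mem hxs
      exact wheelGraph_induce_connected_of_hub_mem hs hmem hlen hv hk fun y hy hyA =>
        hcard y ⟨hyA, (hmem y).1 hy⟩ _ ⟨hxA, (hmem _).1 hxs⟩
    · exact wheelGraph_induce_connected_of_hub_mem hs hmem hlen hv
        (show 0 < s.length by omega) fun y hy hyA => absurd ⟨y, hy, hyA⟩ hex
  · rw [SimpleGraph.connected_iff_exists_forall_reachable]
    refine ⟨⟨v, hv⟩, ?_⟩
    rintro ⟨x, hx⟩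
    by_cases hxv : x = v
    · subst hxv
      exact SimpleGraph.Reachable.refl _
    · exact SimpleGraph.Adj.reachable
        (wheelGraph_adj_hub ((hmem x).2 hxv) (Ne.symm hxv))

theorem copyMap_eq_inr {V : Type*} [DecidableEq V] {h₁ h₂ h₃ : V} (i : Fin 3)
    (u : {x : V // x ≠ h₁ ∧ x ≠ h₂ ∧ x ≠ h₃}) :
    copyMap h₁ h₂ h₃ i u = Sum.inr (u, i) :=
  dif_pos u.2

theorem copyMap_eq_inl {V : Type*} [DecidableEq V] {h₁ h₂ h₃ : V} (i : Fin 3) {u : V}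
    (hu : ¬ (u ≠ h₁ ∧ u ≠ h₂ ∧ u ≠ h₃)) :
    copyMap h₁ h₂ h₃ i u = Sum.inl (if u = h₂ then 3 else if u = h₁ then
      Fin.castLE (by norm_num) i else Fin.castLE (by norm_num) (i + 2)) :=
  (dif_neg hu).trans (by rw [apply_ite Sum.inl, apply_ite Sum.inl]; rfl)

theorem copyMap_injective {V : Type*} [DecidableEq V] {h₁ h₂ h₃ : V} (i : Fin 3) :
    Function.Injective (copyMap h₁ h₂ h₃ i) := by
  intro a b hab
  by_cases ha : a ≠ h₁ ∧ a ≠ h₂ ∧ a ≠ h₃ <;> by_cases hb : b ≠ h₁ ∧ b ≠ h₂ ∧ b ≠ h₃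
  · have := (copyMap_eq_inr i ⟨a, ha⟩).symm.trans (hab.trans (copyMap_eq_inr i ⟨b, hb⟩))
    exact congrArg (fun p => p.1.1) (Sum.inr_injective this)
  · exact absurd ((copyMap_eq_inr i ⟨a, ha⟩).symm.trans (hab.trans (copyMap_eq_inl i hb)))
      Sum.inr_ne_inl
  · exact absurd ((copyMap_eq_inl i ha).symm.trans (hab.trans (copyMap_eq_inr i ⟨b, hb⟩)))
      Sum.inl_ne_inr
  · have := Sum.inl_injective
      ((copyMap_eq_inl i ha).symm.trans (hab.trans (copyMap_eq_inl i hb)))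
    fin_cases i <;> split_ifs at this <;> simp_all [Fin.ext_iff]

theorem TGraph_adj_frame {V : Type*} [DecidableEq V] {h₁ h₂ h₃ v : V} {s : List V}
    {x y : Fin 4} (hxy : x ≠ y) :
    (TGraph h₁ h₂ h₃ v s).Adj (Sum.inl x) (Sum.inl y) := by
  refine (SimpleGraph.fromRel_adj _ _ _).2 ?_
  exact ⟨fun h => hxy (Sum.inl_injective h), Or.inl (Or.inl ⟨x, y, rfl, rfl⟩)⟩

theorem TGraph_adj_copyMap {V : Type*} [DecidableEq V] {h₁ h₂ h₃ v : V} {s : List V}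
    (i : Fin 3) {u w : V} (h : (wheelGraph v s).Adj u w) :
    (TGraph h₁ h₂ h₃ v s).Adj (copyMap h₁ h₂ h₃ i u) (copyMap h₁ h₂ h₃ i w) := by
  refine (SimpleGraph.fromRel_adj _ _ _).2 ?_
  exact ⟨fun he => h.ne (copyMap_injective i he), Or.inl (Or.inr ⟨i, u, w, h, rfl, rfl⟩)⟩

instance {V : Type*} [Finite V] (h₁ h₂ h₃ : V) : Finite (TVert V h₁ h₂ h₃) :=
  inferInstanceAs (Finite (Fin 4 ⊕ ({x : V // x ≠ h₁ ∧ x ≠ h₂ ∧ x ≠ h₃} × Fin 3)))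

/-- An injective map sends some element of a set of more than `n` elements outside any set of
at most `n` elements. -/
theorem exists_mem_apply_notMem {α β : Type*} [Finite β] {f : α → β}
    (hf : Function.Injective f) {A : Set α} {B : Set β} (h : B.ncard < A.ncard) :
    ∃ a ∈ A, f a ∉ B := by
  by_contra! hAB
  exact absurd (Set.ncard_le_ncard_of_injOn f hAB hf.injOn (Set.toFinite B)) (by omega)

theorem TGraph_threeConnected_of_wheel {V : Type*} [Finite V] [DecidableEq V]
    {h₁ h₂ h₃ v : V} {s : List V} (h12 : h₁ ≠ h₂) (h13 : h₁ ≠ h₃) (h23 : h₂ ≠ h₃)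
    (hW : ThreeConnected (wheelGraph v s)) : ThreeConnected (TGraph h₁ h₂ h₃ v s) := by
  intro A hA
  obtain ⟨t, -, ht⟩ : ∃ t ∈ (Set.univ : Set (Fin 4)),
      (Sum.inl t : TVert V h₁ h₂ h₃) ∉ A :=
    exists_mem_apply_notMem Sum.inl_injective (hA.trans_lt (by simp [Set.ncard_univ]))
  rw [SimpleGraph.connected_iff_exists_forall_reachable]
  refine ⟨⟨Sum.inl t, ht⟩, ?_⟩
  have hframe (x : Fin 4) (hx : (Sum.inl x : TVert V h₁ h₂ h₃) ∈ Aᶜ) :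
      ((TGraph h₁ h₂ h₃ v s).induce Aᶜ).Reachable ⟨Sum.inl t, ht⟩ ⟨Sum.inl x, hx⟩ := by
    by_cases htx : t = x
    · subst htx
      exact SimpleGraph.Reachable.refl _
    · exact SimpleGraph.Adj.reachable (TGraph_adj_frame htx)
  rintro ⟨x | ⟨u, i⟩, hx⟩
  · exact hframe x hx
  have hinj := copyMap_injective (h₁ := h₁) (h₂ := h₂) (h₃ := h₃) i
  obtain ⟨h, hh, hhA⟩ : ∃ h ∈ ({h₁, h₂, h₃} : Set V), copyMap h₁ h₂ h₃ i h ∉ A :=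
    exists_mem_apply_notMem hinj (by
      rw [Set.ncard_eq_three.2 ⟨h₁, h₂, h₃, h12, h13, h23, rfl⟩]
      omega)
  obtain ⟨y, hy⟩ : ∃ y : Fin 4, copyMap h₁ h₂ h₃ i h = Sum.inl y :=
    ⟨_, copyMap_eq_inl i fun ⟨ha, hb, hc⟩ => hh.elim ha (Or.elim · hb hc)⟩
  have hyA : (Sum.inl y : TVert V h₁ h₂ h₃) ∈ Aᶜ := hy ▸ hhA
  refine (hframe y hyA).trans ?_
  have hpre : (copyMap h₁ h₂ h₃ i ⁻¹' A).ncard ≤ 2 :=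
    (Set.ncard_le_ncard_of_injOn (copyMap h₁ h₂ h₃ i) (fun a ha => ha) hinj.injOn (Set.toFinite A)).trans hA
  have hu : (u : V) ∈ (copyMap h₁ h₂ h₃ i ⁻¹' A)ᶜ := by
    intro hu
    rw [Set.mem_preimage, copyMap_eq_inr] at hu
    exact hx hu
  let f : (wheelGraph v s).induce (copyMap h₁ h₂ h₃ i ⁻¹' A)ᶜ →g
      (TGraph h₁ h₂ h₃ v s).induce Aᶜ :=
    { toFun := fun a => ⟨copyMap h₁ h₂ h₃ i a, a.2⟩
      map_rel' := fun hab => TGraph_adj_copyMap i hab }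
  have hreach := ((hW _ hpre).preconnected ⟨h, hhA⟩ ⟨u, hu⟩).map f
  have hfh : f ⟨h, hhA⟩ = ⟨Sum.inl y, hyA⟩ := Subtype.ext hy
  have hfu : f ⟨u, hu⟩ = ⟨Sum.inr (u, i), hx⟩ := Subtype.ext (copyMap_eq_inr i u)
  rwa [hfh, hfu] at hreach

theorem TGraph_threeConnected {V : Type*} [Fintype V] [DecidableEq V]
    (χ : V → V → V → ℤ) (hn : 4 ≤ Fintype.card V) (hχ : IsOrderType χ)
    (h₁ h₂ h₃ : V) (hhull : IsConvexHullSeq χ 3 (tripleHull h₁ h₂ h₃))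
    (S : V → List V)
    (hShull : ∀ v ∈ ({h₁, h₂, h₃} : Set V), IsHullSurroundSeq χ v (S v))
    (hSint : ∀ v ∉ ({h₁, h₂, h₃} : Set V), IsInternalSurroundSeq χ v (S v)) :
    ∀ v : V, ThreeConnected (TGraph h₁ h₂ h₃ v (S v)) := by
  intro v
  have hinj := hhull.2.1
  have h12 : h₁ ≠ h₂ := hinj.ne (show (0 : ZMod 3) ≠ 1 by decide)
  have h13 : h₁ ≠ h₃ := hinj.ne (show (0 : ZMod 3) ≠ 2 by decide)
  have h23 : h₂ ≠ h₃ := hinj.ne (show (1 : ZMod 3) ≠ 2 by decide)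
  obtain ⟨hs, hmem⟩ : (S v).Nodup ∧ ∀ x : V, x ∈ S v ↔ x ≠ v := by
    by_cases hv : v ∈ ({h₁, h₂, h₃} : Set V)
    · exact ⟨(hShull v hv).1, (hShull v hv).2.1⟩
    · exact ⟨(hSint v hv).1, (hSint v hv).2.1⟩
  have hlen : (S v).length = Fintype.card V - 1 := by
    have hset : (S v).toFinset = Finset.univ.erase v := by
      ext x
      simp [hmem]
    rw [← List.toFinset_card_of_nodup hs, hset, Finset.card_erase_of_mem (Finset.mem_univ v),
      Finset.card_univ]
  exact TGraph_threeConnected_of_wheel h12 h13 h23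
    (wheelGraph_threeConnected hs hmem (by omega))
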